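/- Let 0 < c1 < c2, αA > αB > 0, demands dA, dB > 0 with D = dA + dB satisfying c2 − √(c1·c2) < D < c1 + c2, and suppose dA = f^opt_1 and dB = f^opt_2 where f^opt_1 = ((D − c2)√c1 + c1√c2)/(√c1 + √c2) and f^opt_2 = ((D − c1)√c2 + c2√c1)/(√c1 + √c2). Then, with τ1 = 0, the class-decomposed flow f_{1,A} = dA, f_{2,A} = 0, f_{1,B} = 0, f_{2,B} = dB is a taxed Wardrop equilibrium if and only if the tax τ2 on network 2 satisfies (c2 − c1)/( αA·√(c1·c2)·(c1 + c2 − D) ) ≤ τ2 ≤ (c2 − c1)/( αB·√(c1·c2)·(c1 + c2 − D) ). -/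

import Mathlib

/-- When `dA = f^opt_1` and `dB = f^opt_2`, with `τ1 = 0`, the class-decomposed
flow `f_{1,A} = dA`, `f_{2,A} = 0`, `f_{1,B} = 0`, `f_{2,B} = dB` is a taxed
Wardrop equilibrium if and only if the tax `τ2` on network 2 satisfies
`(c2 - c1)/(αA √(c1 c2) (c1 + c2 - D)) ≤ τ2 ≤ (c2 - c1)/(αB √(c1 c2) (c1 + c2 - D))`. -/
theorem optimal_tax_range_iff_equilibrium
    (c1 c2 dA dB D αA αB τ1 τ2 fopt1 fopt2 : ℝ)
    (hc1 : 0 < c1) (hc12 : c1 < c2)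
    (hdA : 0 < dA) (hdB : 0 < dB) (hD : D = dA + dB)
    (hDgt : c2 - Real.sqrt (c1 * c2) < D) (hDlt : D < c1 + c2)
    (hαB : 0 < αB) (hαAB : αB < αA)
    (hopt1 : fopt1 = ((D - c2) * Real.sqrt c1 + c1 * Real.sqrt c2) / (Real.sqrt c1 + Real.sqrt c2))
    (hopt2 : fopt2 = ((D - c1) * Real.sqrt c2 + c2 * Real.sqrt c1) / (Real.sqrt c1 + Real.sqrt c2))
    (hdAeq : dA = fopt1) (hdBeq : dB = fopt2)
    (hτ1 : τ1 = 0)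
    (f1A f2A f1B f2B : ℝ)
    (hf1A : f1A = dA) (hf2A : f2A = 0) (hf1B : f1B = 0) (hf2B : f2B = dB) :
    ((0 < f1A →
        1 / (c1 - (f1A + f1B)) + αA * τ1 ≤ 1 / (c2 - (f2A + f2B)) + αA * τ2) ∧
     (0 < f2A →
        1 / (c2 - (f2A + f2B)) + αA * τ2 ≤ 1 / (c1 - (f1A + f1B)) + αA * τ1) ∧
     (0 < f1B →
        1 / (c1 - (f1A + f1B)) + αB * τ1 ≤ 1 / (c2 - (f2A + f2B)) + αB * τ2) ∧
     (0 < f2B →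
        1 / (c2 - (f2A + f2B)) + αB * τ2 ≤ 1 / (c1 - (f1A + f1B)) + αB * τ1)) ↔
    ((c2 - c1) / (αA * Real.sqrt (c1 * c2) * (c1 + c2 - D)) ≤ τ2 ∧
      τ2 ≤ (c2 - c1) / (αB * Real.sqrt (c1 * c2) * (c1 + c2 - D))) := by
  have hc2 : 0 < c2 := hc1.trans hc12
  have hαA : 0 < αA := hαB.trans hαAB
  have h1 : 0 < Real.sqrt c1 := Real.sqrt_pos.mpr hc1
  have h2 : 0 < Real.sqrt c2 := Real.sqrt_pos.mpr hc2
  have q1 : Real.sqrt c1 ^ 2 = c1 := Real.sq_sqrt hc1.le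
  have q2 : Real.sqrt c2 ^ 2 = c2 := Real.sq_sqrt hc2.le
  have hs : Real.sqrt (c1 * c2) = Real.sqrt c1 * Real.sqrt c2 := Real.sqrt_mul hc1.le c2
  have hR : 0 < c1 + c2 - D := by linarith
  have e1 : c1 - dA = Real.sqrt c1 * (c1 + c2 - D) / (Real.sqrt c1 + Real.sqrt c2) := by
    rw [hdAeq, hopt1]
    field_simp
    ring
  have e2 : c2 - dB = Real.sqrt c2 * (c1 + c2 - D) / (Real.sqrt c1 + Real.sqrt c2) := by
    rw [hdBeq, hopt2]
    field_simp
    ring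
  have key : 1 / (c1 - dA) - 1 / (c2 - dB)
      = (c2 - c1) / (Real.sqrt (c1 * c2) * (c1 + c2 - D)) := by
    rw [e1, e2, hs]
    generalize c1 + c2 - D = R at hR
    have : c2 - c1 = (Real.sqrt c2 - Real.sqrt c1) * (Real.sqrt c1 + Real.sqrt c2) := by
      linear_combination q1 - q2
    rw [this]
    field_simp
  have t : ∀ a : ℝ, (c2 - c1) / (a * Real.sqrt (c1 * c2) * (c1 + c2 - D))
      = (1 / (c1 - dA) - 1 / (c2 - dB)) / a := by
    intro a
    rw [key, div_div]
    congr 1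
    ring
  rw [t, t, div_le_iff₀ hαA, le_div_iff₀ hαB, hf1A, hf2A, hf1B, hf2B, hτ1]
  simp only [add_zero, zero_add, mul_zero, lt_irrefl, false_imp_iff, true_and, hdA, hdB,
    forall_const]
  constructor
  · rintro ⟨ha, hb⟩
    constructor <;> linarith
  · rintro ⟨ha, hb⟩
    constructor <;> linarith
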